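/- Let G be a finite group. For each conjugacy class C' of G fix a representative r_{C'} ∈ C', a transversal p_{C'} : C' → G with p_{C'}(c)·r_{C'}·p_{C'}(c)⁻¹ = c, and a complete set Irr(Z(r_{C'})) of pairwise non-isomorphic irreducible unitary representations of Z(r_{C'}). For pairs (C,R) and (C',R') (with R an irreducible unitary representation of Z(r_C) and R' one of Z(r_{C'})) define the S-matrix entry S_{(C,R),(C',R')} := (1/|G|)·Σ_{c∈C} Σ_{c'∈C'} [c·c' = c'·c]·conj(χ^R(p_C(c)⁻¹·c'·p_C(c)))·conj(χ^{R'}(p_{C'}(c')⁻¹·c·p_{C'}(c'))), where [·] is 1 if the condition holds and 0 otherwise (note p_C(c)⁻¹·c'·p_C(c) ∈ Z(r_C) and p_{C'}(c')⁻¹·c·p_{C'}(c') ∈ Z(r_{C'}) whenever c and c' commute). Then for every pair (C,R), as functions G × G → ℂ: M^{[C,R]} = |G|·Σ over conjugacy classes C' and over R' ∈ Irr(Z(r_{C'})) of conj(S_{(C,R),(C',R')})·(1/(|C'|·d_{R'}))·P^{[C',R']}. -/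

import Mathlib

/-!
Statement 17: Expansion of the trace anyon-creating operator `M^{[C,R]}` in terms of the
trace probing operators via the S-matrix of the quantum double:
`M^{[C,R]} = |G|·Σ_{C',R'} conj(S_{(C,R),(C',R')})·(1/(|C'|·d_{R'}))·P^{[C',R']}`.
-/

open scoped Classical

noncomputable section

/-- `F^{g,h}`: the indicator function of the pair `(g,h)`. -/
def Fgh {G : Type*} (g h : G) : G × G → ℂ := fun x => if x = (g, h) then 1 else 0

/-- The conjugacy class of `r` in `G`, as a `Finset`. -/
def conjClass {G : Type*} [Group G] [Fintype G] (r : G) : Finset G :=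
  Finset.image (fun g => g * r * g⁻¹) Finset.univ

/-- The centralizer `Z(r)` of `r` in `G`, as a `Finset`. -/
def centFinset {G : Type*} [Group G] [Fintype G] (r : G) : Finset G :=
  Finset.univ.filter fun z => z * r = r * z

/-- `ρ : G → Matrix (Fin d) (Fin d) ℂ` restricts to a unitary representation of `Z(r)`. -/
def IsCentRep {G : Type*} [Group G] [Fintype G] (r : G) {d : ℕ}
    (ρ : G → Matrix (Fin d) (Fin d) ℂ) : Prop :=
  ρ 1 = 1 ∧
  (∀ z w : G, z * r = r * z → w * r = r * w → ρ (z * w) = ρ z * ρ w) ∧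
  (∀ z : G, z * r = r * z → ρ z ∈ Matrix.unitaryGroup (Fin d) ℂ)

/-- `ρ` restricts to an irreducible unitary representation of `Z(r)`. -/
def IsCentIrrep {G : Type*} [Group G] [Fintype G] (r : G) {d : ℕ}
    (ρ : G → Matrix (Fin d) (Fin d) ℂ) : Prop :=
  IsCentRep r ρ ∧
  ∀ M : Matrix (Fin d) (Fin d) ℂ,
    (∀ z : G, z * r = r * z → M * ρ z = ρ z * M) →
    ∃ c : ℂ, M = c • (1 : Matrix (Fin d) (Fin d) ℂ)

/-- Isomorphism of two representations of the centralizer `Z(r)`. -/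
def RepIsoOn {G : Type*} [Group G] [Fintype G] (r : G) {d₁ d₂ : ℕ}
    (ρ₁ : G → Matrix (Fin d₁) (Fin d₁) ℂ) (ρ₂ : G → Matrix (Fin d₂) (Fin d₂) ℂ) : Prop :=
  ∃ (U : Matrix (Fin d₁) (Fin d₂) ℂ) (V : Matrix (Fin d₂) (Fin d₁) ℂ),
    U * V = 1 ∧ V * U = 1 ∧ ∀ z : G, z * r = r * z → ρ₁ z * U = U * ρ₂ z

/-- The trace anyon-creating operator
`M^{[C,R]} := Σ_{c∈C} Σ_{z∈Z(r)} χ^R(z)·F^{p(c)·z·p(c)⁻¹, c}`. -/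
def Mtr {G : Type*} [Group G] [Fintype G] (r : G) (p : G → G) {d : ℕ}
    (ρ : G → Matrix (Fin d) (Fin d) ℂ) : G × G → ℂ :=
  ∑ c ∈ conjClass r, ∑ z ∈ centFinset r, (ρ z).trace • Fgh (p c * z * (p c)⁻¹) c

/-- The trace probing operator
`P^{[C,R]} := (|C|·d_R/|G|)·Σ_{c∈C} Σ_{z∈Z(r)} conj(χ^R(z))·F^{c, p(c)·z·p(c)⁻¹}`. -/
def Ptr {G : Type*} [Group G] [Fintype G] (r : G) (p : G → G) {d : ℕ}
    (ρ : G → Matrix (Fin d) (Fin d) ℂ) : G × G → ℂ :=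
  ((((conjClass r).card : ℂ) * (d : ℂ)) / (Fintype.card G : ℂ)) •
    ∑ c ∈ conjClass r, ∑ z ∈ centFinset r,
      (starRingEnd ℂ) ((ρ z).trace) • Fgh c (p c * z * (p c)⁻¹)

/-- The S-matrix entry
`S_{(C,R),(C',R')} := (1/|G|)·Σ_{c∈C} Σ_{c'∈C'} [c·c' = c'·c]·
  conj(χ^R(p_C(c)⁻¹·c'·p_C(c)))·conj(χ^{R'}(p_{C'}(c')⁻¹·c·p_{C'}(c')))`. -/
def Smat {G : Type*} [Group G] [Fintype G] (r r' : G) (p p' : G → G) {d d' : ℕ}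
    (ρ : G → Matrix (Fin d) (Fin d) ℂ) (ρ' : G → Matrix (Fin d') (Fin d') ℂ) : ℂ :=
  (Fintype.card G : ℂ)⁻¹ *
    ∑ c ∈ conjClass r, ∑ c' ∈ conjClass r',
      (if c * c' = c' * c then (1 : ℂ) else 0) *
        (starRingEnd ℂ) ((ρ ((p c)⁻¹ * c' * p c)).trace) *
        (starRingEnd ℂ) ((ρ' ((p' c')⁻¹ * c * p' c')).trace)

section MatrixRepresentations

open Matrix

variable {H : Type*} [Group H]
  {n : Type*} [Fintype n] [DecidableEq n] {m : Type*} [Fintype m] [DecidableEq m]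

/-- The matrix representation `σ` of `H` is unitary. -/
def IsUnitaryMatrixRep (σ : H →* Matrix n n ℂ) : Prop :=
  ∀ z, σ z ∈ unitaryGroup n ℂ

/-- Only scalar matrices commute with the matrix representation `σ` of `H`. -/
def HasScalarCommutant (σ : H →* Matrix n n ℂ) : Prop :=
  ∀ M : Matrix n n ℂ, (∀ z, M * σ z = σ z * M) → ∃ c : ℂ, M = c • (1 : Matrix n n ℂ)

/-- Isomorphism of matrix representations. -/
def MatrixRepIso (σ : H →* Matrix n n ℂ) (τ : H →* Matrix m m ℂ) : Prop :=
  ∃ (U : Matrix n m ℂ) (V : Matrix m n ℂ), U * V = 1 ∧ V * U = 1 ∧ ∀ z, σ z * U = U * τ z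

theorem IsUnitaryMatrixRep.map_inv {σ : H →* Matrix n n ℂ} (hσ : IsUnitaryMatrixRep σ) (z : H) :
    σ z⁻¹ = (σ z)ᴴ := by
  have h : σ z * σ z⁻¹ = 1 := by rw [← map_mul, mul_inv_cancel, map_one]
  have h' : (σ z)ᴴ * σ z = 1 := mem_unitaryGroup_iff'.1 (hσ z)
  rw [← one_mul (σ z⁻¹), ← h', mul_assoc, h, mul_one]

theorem IsUnitaryMatrixRep.intertwiner_conjTranspose {σ : H →* Matrix n n ℂ}
    {τ : H →* Matrix m m ℂ} (hσ : IsUnitaryMatrixRep σ) (hτ : IsUnitaryMatrixRep τ)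
    {A : Matrix n m ℂ} (hA : ∀ z, σ z * A = A * τ z) (z : H) : τ z * Aᴴ = Aᴴ * σ z := by
  have h := congrArg conjTranspose (hA z⁻¹)
  simpa [hσ.map_inv, hτ.map_inv] using h.symm

theorem trace_mul_conj_of_mul (σ : H →* Matrix n n ℂ) (w z : H) :
    (σ (w⁻¹ * z * w)).trace = (σ z).trace := by
  rw [mul_assoc, map_mul, trace_mul_comm, ← map_mul, mul_assoc, mul_inv_cancel, mul_one]

theorem MatrixRepIso.trace_eq {σ : H →* Matrix n n ℂ} {τ : H →* Matrix m m ℂ}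
    (h : MatrixRepIso σ τ) (z : H) : (σ z).trace = (τ z).trace := by
  obtain ⟨U, V, hUV, hVU, hU⟩ := h
  rw [← mul_one (σ z), ← hUV, ← Matrix.mul_assoc, hU, Matrix.mul_assoc, trace_mul_comm,
    Matrix.mul_assoc, hVU, mul_one]

open scoped ComplexOrder in
theorem intertwiner_eq_zero_of_not_iso {σ : H →* Matrix n n ℂ} {τ : H →* Matrix m m ℂ}
    (hσ : IsUnitaryMatrixRep σ) (hτ : IsUnitaryMatrixRep τ)
    (cσ : HasScalarCommutant σ) (cτ : HasScalarCommutant τ) (hiso : ¬ MatrixRepIso σ τ)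
    {A : Matrix n m ℂ} (hA : ∀ z, σ z * A = A * τ z) : A = 0 := by
  have hA' := hσ.intertwiner_conjTranspose hτ hA
  obtain ⟨c, hc⟩ := cσ (A * Aᴴ) fun z => by
    rw [Matrix.mul_assoc, ← hA', ← Matrix.mul_assoc, ← hA, Matrix.mul_assoc]
  obtain ⟨e, he⟩ := cτ (Aᴴ * A) fun z => by
    rw [Matrix.mul_assoc, ← hA, ← Matrix.mul_assoc, ← hA', Matrix.mul_assoc]
  by_contra hne
  have hce : c = e := by
    have h : c • A = e • A := by
      have := Matrix.mul_assoc A Aᴴ A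
      rwa [hc, he, Matrix.smul_mul, Matrix.one_mul, Matrix.mul_smul, Matrix.mul_one] at this
    exact smul_left_injective ℂ hne h
  have he0 : e ≠ 0 := by
    rintro rfl
    exact hne (conjTranspose_mul_self_eq_zero.1 (by rw [he, zero_smul]))
  subst hce
  refine hiso ⟨A, c⁻¹ • Aᴴ, ?_, ?_, hA⟩
  · rw [Matrix.mul_smul, hc, smul_smul, inv_mul_cancel₀ he0, one_smul]
  · rw [Matrix.smul_mul, he, smul_smul, inv_mul_cancel₀ he0, one_smul]

section FiniteGroup

variable [Fintype H]

theorem sum_mul_mul_inv_intertwines (σ : H →* Matrix n n ℂ) (τ : H →* Matrix m m ℂ)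
    (A : Matrix n m ℂ) (w : H) :
    σ w * ∑ z, σ z * A * τ z⁻¹ = (∑ z, σ z * A * τ z⁻¹) * τ w := by
  rw [Matrix.mul_sum, Matrix.sum_mul]
  refine Fintype.sum_equiv (Equiv.mulLeft w) _ _ fun z => ?_
  have h : τ (w * z)⁻¹ * τ w = τ z⁻¹ := by rw [← map_mul]; simp
  rw [Equiv.coe_mulLeft, Matrix.mul_assoc _ (τ _) (τ w), h, map_mul]
  simp only [Matrix.mul_assoc]

theorem sum_trace_mul_trace_inv (σ : H →* Matrix n n ℂ) (τ : H →* Matrix m m ℂ) :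
    ∑ z, (σ z).trace * (τ z⁻¹).trace =
      ∑ a, ∑ b, (∑ z, σ z * (single a b 1 : Matrix n m ℂ) * τ z⁻¹) a b := by
  simp only [Matrix.sum_apply]
  have key (z : H) (a : n) (b : m) :
      (σ z * (single a b 1 : Matrix n m ℂ) * τ z⁻¹) a b = σ z a a * τ z⁻¹ b b := by
    rw [Matrix.mul_apply, Finset.sum_eq_single b]
    · simp
    · intro k _ hk
      rw [mul_single_apply_of_ne _ _ _ _ _ hk, zero_mul]
    · simp
  simp only [key, Matrix.trace, Matrix.diag, Finset.sum_mul_sum]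
  rw [Finset.sum_comm]
  exact Finset.sum_congr rfl fun a _ => Finset.sum_comm

theorem sum_trace_mul_trace_inv_of_not_iso {σ : H →* Matrix n n ℂ} {τ : H →* Matrix m m ℂ}
    (hσ : IsUnitaryMatrixRep σ) (hτ : IsUnitaryMatrixRep τ)
    (cσ : HasScalarCommutant σ) (cτ : HasScalarCommutant τ) (hiso : ¬ MatrixRepIso σ τ) :
    ∑ z, (σ z).trace * (τ z⁻¹).trace = 0 := by
  rw [sum_trace_mul_trace_inv]
  refine Finset.sum_eq_zero fun a _ => Finset.sum_eq_zero fun b _ => ?_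
  rw [intertwiner_eq_zero_of_not_iso hσ hτ cσ cτ hiso (sum_mul_mul_inv_intertwines σ τ _),
    Matrix.zero_apply]

theorem sum_trace_mul_trace_inv_self [Nonempty n] {σ : H →* Matrix n n ℂ}
    (cσ : HasScalarCommutant σ) :
    ∑ z, (σ z).trace * (σ z⁻¹).trace = Fintype.card H := by
  rw [sum_trace_mul_trace_inv]
  have hn : (Fintype.card n : ℂ) ≠ 0 := by simp
  have key (a b : n) : (∑ z, σ z * (single a b 1 : Matrix n n ℂ) * σ z⁻¹) a b =
      if a = b then (Fintype.card H : ℂ) / Fintype.card n else 0 := by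
    obtain ⟨c, hc⟩ := cσ _ fun w => (sum_mul_mul_inv_intertwines σ σ (single a b 1) w).symm
    have ht := congrArg trace hc
    have hz (z : H) : (σ z * (single a b 1 : Matrix n n ℂ) * σ z⁻¹).trace = ((single a b 1 : Matrix n n ℂ)).trace := by
      rw [trace_mul_comm, ← mul_assoc, ← map_mul, inv_mul_cancel, map_one, one_mul]
    rw [trace_sum, Finset.sum_congr rfl fun z _ => hz z, trace_smul, trace_one] at ht
    rw [hc]
    by_cases hab : a = b
    · subst hab
      simp at ht
      simp [ht, hn]
    · simp [hab]
  simp only [key]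
  simp
  field_simp

/-- A class function whose pairing with an irreducible character vanishes acts by zero in the
corresponding representation. -/
theorem sum_smul_eq_zero_of_sum_trace_eq_zero {σ : H →* Matrix n n ℂ}
    (cσ : HasScalarCommutant σ) {f : H → ℂ} (hf : ∀ w z, f (w * z * w⁻¹) = f z)
    (h : ∑ z, f z * (σ z).trace = 0) : ∑ z, f z • σ z = 0 := by
  obtain ⟨c, hc⟩ := cσ (∑ z, f z • σ z) fun w => by
    rw [Matrix.mul_sum, Matrix.sum_mul]
    refine Fintype.sum_equiv (MulAut.conj w⁻¹).toEquiv _ _ fun z => ?_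
    have h1 : f (w⁻¹ * (z * w)) = f z := by simpa [mul_assoc] using hf w⁻¹ z
    simp [← map_mul, mul_assoc, h1]
  have ht := congrArg trace hc
  simp only [trace_sum, trace_smul, trace_one, smul_eq_mul] at ht
  rw [h] at ht
  rcases mul_eq_zero.1 ht.symm with h0 | h0
  · rw [hc, h0, zero_smul]
  · have : IsEmpty n := Fintype.card_eq_zero_iff.1 (by exact_mod_cast h0)
    exact Subsingleton.elim _ _

end FiniteGroup

/-- If the commutant of a unitary representation is not scalar, it contains a nonscalar Hermitian
matrix. -/
theorem exists_isHermitian_commute_of_not_hasScalarCommutant {σ : H →* Matrix n n ℂ}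
    (hσ : IsUnitaryMatrixRep σ) (h : ¬ HasScalarCommutant σ) :
    ∃ M : Matrix n n ℂ, M.IsHermitian ∧ (∀ z, M * σ z = σ z * M) ∧
      ∀ c : ℂ, M ≠ c • (1 : Matrix n n ℂ) := by
  by_contra! hall
  refine h fun M hM => ?_
  have hM' (z : H) : Mᴴ * σ z = σ z * Mᴴ :=
    (hσ.intertwiner_conjTranspose hσ (fun z => (hM z).symm) z).symm
  obtain ⟨a, ha⟩ := hall (M + Mᴴ) (isHermitian_add_transpose_self M) fun z => by
    rw [add_mul, mul_add, hM, hM']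
  obtain ⟨b, hb⟩ := hall (Complex.I • (M - Mᴴ)) (by
      simp [IsHermitian, conjTranspose_smul, smul_sub, neg_add_eq_sub]) fun z => by
    rw [smul_mul_assoc, sub_mul, mul_smul_comm, mul_sub, hM, hM']
  refine ⟨2⁻¹ * (a - Complex.I * b), ?_⟩
  rw [mul_smul, sub_smul, mul_smul, ← ha, ← hb, smul_smul, Complex.I_mul_I]
  module

/-- The representation on the block of indices `{j | p j}`, when it is invariant. -/
def blockRep (σ : H →* Matrix n n ℂ) (p : n → Prop) [DecidablePred p]
    (hp : ∀ z i j, p i → ¬ p j → σ z i j = 0) :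
    H →* Matrix {j // p j} {j // p j} ℂ where
  toFun z := (σ z).submatrix Subtype.val Subtype.val
  map_one' := by simp [Matrix.submatrix_one _ Subtype.val_injective]
  map_mul' z w := by
    ext i j
    rw [map_mul, submatrix_apply, Matrix.mul_apply, Matrix.mul_apply,
      ← Fintype.sum_subtype_add_sum_subtype p]
    simp only [submatrix_apply, add_eq_left]
    exact Finset.sum_eq_zero fun k _ => by rw [hp z i k i.2 k.2, zero_mul]

theorem IsUnitaryMatrixRep.blockRep {σ : H →* Matrix n n ℂ} (hσ : IsUnitaryMatrixRep σ)
    (p : n → Prop) [DecidablePred p] (hp : ∀ z i j, p i → ¬ p j → σ z i j = 0) :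
    IsUnitaryMatrixRep (_root_.blockRep σ p hp) := by
  intro z
  have h : (_root_.blockRep σ p hp z)ᴴ = _root_.blockRep σ p hp z⁻¹ := by
    change ((σ z).submatrix _ _)ᴴ = (σ z⁻¹).submatrix _ _
    rw [hσ.map_inv, conjTranspose_submatrix]
  rw [mem_unitaryGroup_iff, star_eq_conjTranspose, h, ← map_mul, mul_inv_cancel, map_one]

/-- An algebra isomorphism compatible with the conjugate transpose preserves unitarity. -/
theorem IsUnitaryMatrixRep.comp {σ : H →* Matrix n n ℂ} (hσ : IsUnitaryMatrixRep σ)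
    (φ : Matrix n n ℂ ≃ₐ[ℂ] Matrix m m ℂ) (hφ : ∀ A, φ Aᴴ = (φ A)ᴴ) :
    IsUnitaryMatrixRep ((φ : Matrix n n ℂ →* Matrix m m ℂ).comp σ) := by
  intro z
  change φ (σ z) ∈ _
  rw [mem_unitaryGroup_iff, star_eq_conjTranspose, ← hφ, ← map_mul,
    ← star_eq_conjTranspose, mem_unitaryGroup_iff.1 (hσ z), map_one]

variable [Fintype H]

theorem sum_smul_eq_zero_of_comp {σ : H →* Matrix n n ℂ} (φ : Matrix n n ℂ ≃ₐ[ℂ] Matrix m m ℂ)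
    {f : H → ℂ} (h : ∑ z, f z • ((φ : Matrix n n ℂ →* Matrix m m ℂ).comp σ) z = 0) :
    ∑ z, f z • σ z = 0 := by
  apply φ.injective
  rw [map_zero, map_sum, ← h]
  exact Finset.sum_congr rfl fun z _ => map_smul φ _ _

theorem sum_smul_eq_zero_of_fin {f : H → ℂ}
    (hf : ∀ τ : H →* Matrix (Fin (Fintype.card n)) (Fin (Fintype.card n)) ℂ,
      IsUnitaryMatrixRep τ → ∑ z, f z • τ z = 0)
    {σ : H →* Matrix n n ℂ} (hσ : IsUnitaryMatrixRep σ) : ∑ z, f z • σ z = 0 :=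
  sum_smul_eq_zero_of_comp (reindexAlgEquiv ℂ ℂ (Fintype.equivFin n))
    (hf _ (hσ.comp _ fun A => by simp))

/-- If a linear combination of group elements acts by zero in every irreducible unitary
representation, it acts by zero in every unitary representation. -/
theorem sum_smul_eq_zero_of_irreducible {f : H → ℂ}
    (hf : ∀ (k : ℕ) (τ : H →* Matrix (Fin k) (Fin k) ℂ), IsUnitaryMatrixRep τ →
      HasScalarCommutant τ → ∑ z, f z • τ z = 0)
    {σ : H →* Matrix n n ℂ} (hσ : IsUnitaryMatrixRep σ) : ∑ z, f z • σ z = 0 := by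
  refine sum_smul_eq_zero_of_fin (fun τ hτ => ?_) hσ
  generalize Fintype.card n = k at τ hτ
  induction k using Nat.strong_induction_on with
  | _ k ih =>
    by_cases cτ : HasScalarCommutant τ
    · exact hf k τ hτ cτ
    obtain ⟨M, hM, hcomm, hns⟩ := exists_isHermitian_commute_of_not_hasScalarCommutant hτ cτ
    let ψ := (Unitary.conjStarAlgAut ℂ _ hM.eigenvectorUnitary).symm
    let φ : Matrix (Fin k) (Fin k) ℂ ≃ₐ[ℂ] Matrix (Fin k) (Fin k) ℂ := ψ.toAlgEquiv
    let D : Fin k → ℂ := RCLike.ofReal ∘ hM.eigenvalues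
    have hφM : φ M = diagonal D := by
      change ψ M = _
      conv_lhs => rw [hM.spectral_theorem]
      exact StarAlgEquiv.symm_apply_apply _ _
    refine sum_smul_eq_zero_of_comp φ ?_
    have hτ' := hτ.comp φ fun A => map_star ψ A
    set τ' := (φ : Matrix (Fin k) (Fin k) ℂ →* Matrix (Fin k) (Fin k) ℂ).comp τ
    have hτD (z : H) (i j : Fin k) (hij : D i ≠ D j) : τ' z i j = 0 := by
      have h : φ M * φ (τ z) = φ (τ z) * φ M := by rw [← map_mul, hcomm, map_mul]
      have h' := congrFun (congrFun h i) j
      rw [hφM, diagonal_mul, mul_diagonal, mul_comm, ← sub_eq_zero, ← mul_sub] at h'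
      exact (mul_eq_zero.1 h').resolve_right (sub_ne_zero.2 hij)
    have hD (c : ℂ) : ∃ l, D l ≠ c := by
      by_contra! h
      refine hns c (φ.injective ?_)
      rw [hφM, map_smul, map_one, funext h, smul_one_eq_diagonal]
    ext i j
    by_cases hij : D i = D j
    · have hp (z : H) (a b : Fin k) (ha : D a = D i) (hb : ¬ D b = D i) : τ' z a b = 0 :=
        hτD z a b fun hab => hb (hab ▸ ha)
      obtain ⟨l, hl⟩ := hD (D i)
      have hlt : Fintype.card {a // D a = D i} < k := by
        simpa using Fintype.card_subtype_lt (p := fun a => D a = D i) hl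
      have h0 := sum_smul_eq_zero_of_fin (ih _ hlt) (hτ'.blockRep (fun a => D a = D i) hp)
      have h1 := congrFun (congrFun h0 ⟨i, rfl⟩) ⟨j, hij.symm⟩
      simpa [Matrix.sum_apply, blockRep] using h1
    · simp [Matrix.sum_apply, hτD _ i j hij]

/-- The left regular representation. -/
def regularMatrixRep (H : Type*) [Group H] [Fintype H] [DecidableEq H] : H →* Matrix H H ℂ where
  toFun z := of fun a b => if a = z * b then 1 else 0
  map_one' := by ext a b; simp [Matrix.one_apply]
  map_mul' z w := by ext a b; simp [Matrix.mul_apply, mul_assoc]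

theorem isUnitaryMatrixRep_regularMatrixRep [DecidableEq H] :
    IsUnitaryMatrixRep (regularMatrixRep H) := by
  intro z
  have h : (regularMatrixRep H z)ᴴ = regularMatrixRep H z⁻¹ := by
    ext a b
    simp [regularMatrixRep, conjTranspose_apply, eq_inv_mul_iff_mul_eq, eq_comm, apply_ite]
  rw [mem_unitaryGroup_iff, star_eq_conjTranspose, h, ← map_mul, mul_inv_cancel, map_one]

/-- A class function orthogonal to all irreducible characters vanishes. -/
theorem eq_zero_of_sum_trace_eq_zero {f : H → ℂ} (hf : ∀ w z, f (w * z * w⁻¹) = f z)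
    (h : ∀ (k : ℕ) (τ : H →* Matrix (Fin k) (Fin k) ℂ), IsUnitaryMatrixRep τ →
      HasScalarCommutant τ → ∑ z, f z * (τ z).trace = 0) : f = 0 := by
  classical
  have h0 := sum_smul_eq_zero_of_irreducible
    (fun k τ hτ cτ => sum_smul_eq_zero_of_sum_trace_eq_zero cτ hf (h k τ hτ cτ))
    (isUnitaryMatrixRep_regularMatrixRep (H := H))
  ext a
  simpa [Matrix.sum_apply, regularMatrixRep] using congrFun (congrFun h0 a) 1

/-- The second orthogonality relation for a complete family of irreducible unitary
representations. -/
theorem sum_trace_mul_trace_inv_eq_card [DecidableEq H] {ι : Type*} [Fintype ι] {d : ι → ℕ}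
    {ρ : ∀ i, H →* Matrix (Fin (d i)) (Fin (d i)) ℂ} (hρ : ∀ i, IsUnitaryMatrixRep (ρ i))
    (cρ : ∀ i, HasScalarCommutant (ρ i)) (hdistinct : ∀ i j, i ≠ j → ¬ MatrixRepIso (ρ i) (ρ j))
    (hcomplete : ∀ (k : ℕ) (τ : H →* Matrix (Fin k) (Fin k) ℂ), IsUnitaryMatrixRep τ →
      HasScalarCommutant τ → ∃ i, MatrixRepIso τ (ρ i)) (x y : H) :
    ∑ i, (ρ i x).trace * (ρ i y⁻¹).trace =
      ((Finset.univ.filter fun w : H => w * x * w⁻¹ = y).card : ℂ) := by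
  let N : H → ℂ := fun z => ∑ w : H, if w * z⁻¹ * w⁻¹ = y then 1 else 0
  let f : H → ℂ := fun z => ∑ i, (ρ i z⁻¹).trace * (ρ i y⁻¹).trace - N z
  have hinv (w z : H) : (w * z * w⁻¹)⁻¹ = w * z⁻¹ * w⁻¹ := by group
  have hf : f = 0 := by
    refine eq_zero_of_sum_trace_eq_zero (fun w z => ?_) fun k τ hτ cτ => ?_
    · have hN : N (w * z * w⁻¹) = N z :=
        Fintype.sum_equiv (Equiv.mulRight w) _ _ fun v => by simp [mul_assoc]
      have hχ (i : ι) : (ρ i (w * z⁻¹ * w⁻¹)).trace = (ρ i z⁻¹).trace := by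
        simpa using trace_mul_conj_of_mul (ρ i) w⁻¹ z⁻¹
      simp only [f, hN, hinv, hχ]
    · obtain ⟨j, hj⟩ := hcomplete k τ hτ cτ
      simp only [hj.trace_eq, f, sub_mul, Finset.sum_sub_distrib, sub_eq_zero]
      have hN : ∑ z, N z * (ρ j z).trace = Fintype.card H * (ρ j y⁻¹).trace := by
        simp only [N, Finset.sum_mul]
        rw [Finset.sum_comm]
        have key (w : H) : ∑ z, (if w * z⁻¹ * w⁻¹ = y then 1 else 0) * (ρ j z).trace =
            (ρ j y⁻¹).trace := by
          have heq (z : H) : w * z⁻¹ * w⁻¹ = y ↔ z = w⁻¹ * y⁻¹ * w := by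
            rw [← hinv, inv_eq_iff_eq_inv, mul_inv_eq_iff_eq_mul, ← eq_inv_mul_iff_mul_eq, mul_assoc]
          simp only [heq, ite_mul, one_mul, zero_mul, Finset.sum_ite_eq', Finset.mem_univ, if_true,
            trace_mul_conj_of_mul]
        rw [Finset.sum_congr rfl fun w _ => key w]
        simp
      rw [hN]
      simp only [Finset.sum_mul]
      rw [Finset.sum_comm, Finset.sum_eq_single j]
      · rcases isEmpty_or_nonempty (Fin (d j)) with he | he
        · simp [Matrix.trace]
        · rw [← sum_trace_mul_trace_inv_self (cρ j), Finset.sum_mul]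
          exact Finset.sum_congr rfl fun z _ => by ring
      · intro i _ hij
        have h := sum_trace_mul_trace_inv_of_not_iso (hρ j) (hρ i) (cρ j) (cρ i)
          (hdistinct j i hij.symm)
        calc _ = (∑ z, (ρ j z).trace * (ρ i z⁻¹).trace) * (ρ i y⁻¹).trace := by
              rw [Finset.sum_mul]
              exact Finset.sum_congr rfl fun z _ => by ring
          _ = 0 := by rw [h, zero_mul]
      · simp
  have h := congrFun hf x⁻¹
  simpa [f, N, sub_eq_zero] using h

end MatrixRepresentations

section Centralizer

variable {G : Type*} [Group G] {r : G}

theorem mem_centralizer_iff_commutes {z : G} :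
    z ∈ Subgroup.centralizer {r} ↔ z * r = r * z :=
  Subgroup.mem_centralizer_singleton_iff

/-- If `q r q⁻¹ = c`, conjugation by `q⁻¹` maps the centralizer of `c` to that of `r`. -/
theorem conj_commutes_iff {q c z : G} (hq : q * r * q⁻¹ = c) :
    (q⁻¹ * z * q) * r = r * (q⁻¹ * z * q) ↔ z * c = c * z := by
  subst hq
  rw [← mul_right_inj q, ← mul_left_inj q⁻¹]
  simp [mul_assoc]

variable [Fintype G]

theorem mem_conjClass {c : G} : c ∈ conjClass r ↔ ∃ g, g * r * g⁻¹ = c := by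
  simp [conjClass]

theorem mem_conjClass_conj_iff {b g : G} : g⁻¹ * b * g ∈ conjClass r ↔ b ∈ conjClass r := by
  simp only [mem_conjClass]
  constructor
  · rintro ⟨h, hh⟩
    have h1 : g * h * r * (g * h)⁻¹ = g * (h * r * h⁻¹) * g⁻¹ := by group
    exact ⟨g * h, by rw [h1, hh]; group⟩
  · rintro ⟨h, hh⟩
    exact ⟨g⁻¹ * h, by rw [← hh]; group⟩

/-- The matrix representation of the centralizer subgroup given by a centralizer
representation. -/
def IsCentRep.toHom {d : ℕ} {ρ : G → Matrix (Fin d) (Fin d) ℂ} (h : IsCentRep r ρ) :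
    Subgroup.centralizer {r} →* Matrix (Fin d) (Fin d) ℂ where
  toFun z := ρ z
  map_one' := h.1
  map_mul' z w :=
    h.2.1 z w (mem_centralizer_iff_commutes.1 z.2) (mem_centralizer_iff_commutes.1 w.2)

theorem IsCentRep.isUnitaryMatrixRep {d : ℕ} {ρ : G → Matrix (Fin d) (Fin d) ℂ}
    (h : IsCentRep r ρ) : IsUnitaryMatrixRep h.toHom :=
  fun z => h.2.2 z (mem_centralizer_iff_commutes.1 z.2)

theorem IsCentIrrep.hasScalarCommutant {d : ℕ} {ρ : G → Matrix (Fin d) (Fin d) ℂ}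
    (h : IsCentIrrep r ρ) : HasScalarCommutant h.1.toHom :=
  fun M hM => h.2 M fun z hz => hM ⟨z, mem_centralizer_iff_commutes.2 hz⟩

theorem IsCentRep.trace_conj {d : ℕ} {ρ : G → Matrix (Fin d) (Fin d) ℂ} (h : IsCentRep r ρ)
    {w z : G} (hw : w * r = r * w) (hz : z * r = r * z) :
    (ρ (w⁻¹ * z * w)).trace = (ρ z).trace :=
  trace_mul_conj_of_mul h.toHom ⟨w, mem_centralizer_iff_commutes.2 hw⟩
    ⟨z, mem_centralizer_iff_commutes.2 hz⟩

/-- The function `c' ↦ χ(p(c)⁻¹ c' p(c))` is invariant under simultaneous conjugation of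
`(c, c')`. -/
theorem IsCentRep.trace_transversal_conj {d : ℕ} {ρ : G → Matrix (Fin d) (Fin d) ℂ}
    (h : IsCentRep r ρ) {p : G → G} (hp : ∀ c ∈ conjClass r, p c * r * (p c)⁻¹ = c) {a b : G}
    (hb : b ∈ conjClass r) (hab : a * b = b * a) (g : G) :
    (ρ ((p (g⁻¹ * b * g))⁻¹ * (g⁻¹ * a * g) * p (g⁻¹ * b * g))).trace =
      (ρ ((p b)⁻¹ * a * p b)).trace := by
  have hc := hp _ (mem_conjClass_conj_iff (g := g).2 hb)
  set q := p (g⁻¹ * b * g)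
  have hb' := hp b hb
  have hw : ((p b)⁻¹ * g * q) * r = r * ((p b)⁻¹ * g * q) := by
    have h1 : g * (q * r * q⁻¹) * g⁻¹ = p b * r * (p b)⁻¹ := by rw [hc, hb']; group
    calc _ = (p b)⁻¹ * (g * (q * r * q⁻¹) * g⁻¹) * g * q := by group
      _ = _ := by rw [h1]; group
  rw [← h.trace_conj hw ((conj_commutes_iff hb').2 hab)]
  congr 2
  group

/-- The second orthogonality relation for representations of a centralizer. -/
theorem sum_trace_mul_conj_trace_eq_card {ι : Type*} [Fintype ι] {d : ι → ℕ}
    {ρ : ∀ i, G → Matrix (Fin (d i)) (Fin (d i)) ℂ} (hirr : ∀ i, IsCentIrrep r (ρ i))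
    (hdistinct : ∀ i j, i ≠ j → ¬ RepIsoOn r (ρ i) (ρ j))
    (hcomplete : ∀ (k : ℕ) (σ : G → Matrix (Fin k) (Fin k) ℂ),
      IsCentIrrep r σ → ∃ i, RepIsoOn r σ (ρ i))
    {x y : G} (hx : x * r = r * x) (hy : y * r = r * y) :
    ∑ i, (ρ i x).trace * (starRingEnd ℂ) (ρ i y).trace =
      ∑ w : G, if w * r = r * w ∧ w * x * w⁻¹ = y then (1 : ℂ) else 0 := by
  have key := sum_trace_mul_trace_inv_eq_card (fun i => (hirr i).1.isUnitaryMatrixRep)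
    (fun i => (hirr i).hasScalarCommutant)
    (fun i j hij ⟨U, V, h1, h2, h3⟩ => hdistinct i j hij
      ⟨U, V, h1, h2, fun z hz => h3 ⟨z, mem_centralizer_iff_commutes.2 hz⟩⟩)
    (fun k τ hτ cτ => by
      let σ : G → Matrix (Fin k) (Fin k) ℂ := fun g =>
        if h : g ∈ Subgroup.centralizer {r} then τ ⟨g, h⟩ else 1
      have hσ (z : G) (hz : z * r = r * z) :
          σ z = τ ⟨z, mem_centralizer_iff_commutes.2 hz⟩ :=
        dif_pos (mem_centralizer_iff_commutes.2 hz)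
      have hirrσ : IsCentIrrep r σ := by
        refine ⟨⟨?_, ?_, ?_⟩, ?_⟩
        · rw [hσ 1 (by simp)]
          exact map_one τ
        · intro z w hz hw
          have hzw : z * w * r = r * (z * w) := by rw [mul_assoc, hw, ← mul_assoc, hz, mul_assoc]
          rw [hσ z hz, hσ w hw, hσ _ hzw, ← map_mul]
          rfl
        · intro z hz
          rw [hσ z hz]
          exact hτ _
        · intro M hM
          refine cτ M fun z => ?_
          have hz := mem_centralizer_iff_commutes.1 z.2
          exact (hσ z hz) ▸ hM z hz
      obtain ⟨i, U, V, h1, h2, h3⟩ := hcomplete k σ hirrσ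
      refine ⟨i, U, V, h1, h2, fun z => ?_⟩
      have hz := mem_centralizer_iff_commutes.1 z.2
      exact (hσ z hz) ▸ h3 z hz)
    ⟨x, mem_centralizer_iff_commutes.2 hx⟩ ⟨y, mem_centralizer_iff_commutes.2 hy⟩
  have hconj (i : ι) : (starRingEnd ℂ) (ρ i y).trace =
      ((hirr i).1.toHom ⟨y, mem_centralizer_iff_commutes.2 hy⟩⁻¹).trace := by
    rw [(hirr i).1.isUnitaryMatrixRep.map_inv, Matrix.trace_conjTranspose]
    rfl
  simp only [hconj]
  refine key.trans ?_
  simp only [ite_and]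
  rw [← Finset.sum_filter, Finset.sum_subtype (p := (· ∈ Subgroup.centralizer {r})) _
    (by simp [mem_centralizer_iff_commutes]), ← Finset.sum_boole]
  exact Finset.sum_congr rfl fun w _ => if_congr Subtype.ext_iff rfl rfl

end Centralizer

section Operators

variable {G : Type*} [Group G] [Fintype G] {r : G} {p : G → G}
  {d : ℕ} (ρ : G → Matrix (Fin d) (Fin d) ℂ)

/-- The sum over the centralizer of `r`, pushed to the centralizer of `c = q r q⁻¹`. -/
theorem sum_centFinset_ite {q c b : G} (hq : q * r * q⁻¹ = c) (f : G → ℂ) :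
    (∑ z ∈ centFinset r, f z * if b = q * z * q⁻¹ then 1 else 0) =
      if b * c = c * b then f (q⁻¹ * b * q) else 0 := by
  have h (z : G) : b = q * z * q⁻¹ ↔ z = q⁻¹ * b * q := by
    rw [eq_mul_inv_iff_mul_eq, ← inv_mul_eq_iff_eq_mul, mul_assoc, eq_comm]
  simp only [h, mul_ite, mul_one, mul_zero, Finset.sum_ite_eq', centFinset, Finset.mem_filter,
    Finset.mem_univ, true_and, conj_commutes_iff hq]

theorem Mtr_apply (hp : ∀ c ∈ conjClass r, p c * r * (p c)⁻¹ = c) (a b : G) :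
    Mtr r p ρ (a, b) =
      if b ∈ conjClass r ∧ a * b = b * a then (ρ ((p b)⁻¹ * a * p b)).trace else 0 := by
  have key (c : G) (hc : c ∈ conjClass r) :
      ∑ z ∈ centFinset r, (ρ z).trace * Fgh (p c * z * (p c)⁻¹) c (a, b) =
        if c = b then (if a * b = b * a then (ρ ((p b)⁻¹ * a * p b)).trace else 0) else 0 := by
    by_cases hcb : c = b
    · subst hcb
      simpa [Fgh] using sum_centFinset_ite (hp c hc) fun z => (ρ z).trace
    · simp [Fgh, hcb, Ne.symm hcb]
  simp only [Mtr, Finset.sum_apply, Pi.smul_apply, smul_eq_mul]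
  rw [Finset.sum_congr rfl key, Finset.sum_ite_eq', ite_and]

theorem Ptr_apply (hp : ∀ c ∈ conjClass r, p c * r * (p c)⁻¹ = c) (a b : G) :
    Ptr r p ρ (a, b) = ((conjClass r).card * d : ℂ) / Fintype.card G *
      if a ∈ conjClass r ∧ a * b = b * a then
        (starRingEnd ℂ) (ρ ((p a)⁻¹ * b * p a)).trace else 0 := by
  have key (c : G) (hc : c ∈ conjClass r) :
      ∑ z ∈ centFinset r, (starRingEnd ℂ) (ρ z).trace * Fgh c (p c * z * (p c)⁻¹) (a, b) =
        if c = a then (if a * b = b * a then (starRingEnd ℂ) (ρ ((p a)⁻¹ * b * p a)).trace else 0)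
          else 0 := by
    by_cases hca : c = a
    · subst hca
      simpa [Fgh, eq_comm] using
        sum_centFinset_ite (b := b) (hp c hc) fun z => (starRingEnd ℂ) (ρ z).trace
    · simp [Fgh, hca, Ne.symm hca]
  simp only [Ptr, Finset.sum_apply, Pi.smul_apply, smul_eq_mul]
  rw [Finset.sum_congr rfl key, Finset.sum_ite_eq', ite_and]

theorem normalized_Ptr_apply (hp : ∀ c ∈ conjClass r, p c * r * (p c)⁻¹ = c) (a b : G) :
    (((conjClass r).card : ℂ) * (d : ℂ))⁻¹ * Ptr r p ρ (a, b) = (Fintype.card G : ℂ)⁻¹ *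
      if a ∈ conjClass r ∧ a * b = b * a then
        (starRingEnd ℂ) (ρ ((p a)⁻¹ * b * p a)).trace else 0 := by
  rw [Ptr_apply ρ hp]
  rcases Nat.eq_zero_or_pos d with rfl | hd
  · simp [Matrix.trace]
  · have h1 : ((conjClass r).card : ℂ) ≠ 0 :=
      Nat.cast_ne_zero.2 (Finset.card_ne_zero_of_mem (mem_conjClass.2 ⟨1, rfl⟩))
    have h2 : (d : ℂ) ≠ 0 := Nat.cast_ne_zero.2 hd.ne'
    field_simp

/-- Elements of `Z(r)` conjugating `q'⁻¹ c q'` to `q⁻¹ b q` correspond to elements of `G` conjugating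
the pair `(q' r q'⁻¹, c)` to the pair `(q r q⁻¹, b)`. -/
theorem sum_centralizer_ite_eq {a b c c' q q' : G} (hq : q * r * q⁻¹ = a)
    (hq' : q' * r * q'⁻¹ = c') :
    (∑ w : G, if w * r = r * w ∧ w * (q'⁻¹ * c * q') * w⁻¹ = q⁻¹ * b * q then (1 : ℂ) else 0) =
      ∑ g : G, if c' = g⁻¹ * a * g ∧ c = g⁻¹ * b * g then 1 else 0 := by
  refine Fintype.sum_equiv ((Equiv.mulLeft q).trans (Equiv.mulRight q'⁻¹)) _ _ fun w => ?_
  subst hq hq'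
  have h1 : (q * w * q'⁻¹)⁻¹ * (q * r * q⁻¹) * (q * w * q'⁻¹) = q' * (w⁻¹ * (r * w)) * q'⁻¹ := by
    group
  have h2 : (q * w * q'⁻¹)⁻¹ * b * (q * w * q'⁻¹) = q' * (w⁻¹ * (q⁻¹ * b * q * w)) * q'⁻¹ := by
    group
  simp only [Equiv.trans_apply, Equiv.coe_mulLeft, Equiv.coe_mulRight, h1, h2]
  refine if_congr (and_congr ?_ ?_) rfl rfl
  · rw [mul_left_inj, mul_right_inj, eq_inv_mul_iff_mul_eq]
  · rw [mul_inv_eq_iff_eq_mul, eq_mul_inv_iff_mul_eq, ← inv_mul_eq_iff_eq_mul (a := q'),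
      eq_inv_mul_iff_mul_eq, mul_assoc q'⁻¹]

theorem conj_Smat {r' : G} {p' : G → G} {d' : ℕ} (ρ' : G → Matrix (Fin d') (Fin d') ℂ) :
    (starRingEnd ℂ) (Smat r r' p p' ρ ρ') = (Fintype.card G : ℂ)⁻¹ *
      ∑ c ∈ conjClass r, ∑ c' ∈ conjClass r', if c * c' = c' * c then
        (ρ ((p c)⁻¹ * c' * p c)).trace * (ρ' ((p' c')⁻¹ * c * p' c')).trace else 0 := by
  simp [Smat, map_sum, apply_ite, ite_mul]

end Operators

theorem creating_from_probing_via_S (G : Type*) [Group G] [Fintype G]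
    -- a set of representatives of the conjugacy classes of G
    (T : Finset G) (hT : ∀ g : G, ∃! r, r ∈ T ∧ g ∈ conjClass r)
    -- transversals
    (p : G → G → G) (hp : ∀ r ∈ T, ∀ c ∈ conjClass r, p r c * r * (p r c)⁻¹ = c)
    -- complete families of pairwise non-isomorphic irreducible unitary representations
    (ι : G → Type) [∀ r, Fintype (ι r)]
    (d : ∀ r, ι r → ℕ)
    (ρ : ∀ r, ∀ i : ι r, G → Matrix (Fin (d r i)) (Fin (d r i)) ℂ)
    (hirr : ∀ r ∈ T, ∀ i : ι r, IsCentIrrep r (ρ r i))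
    (hdistinct : ∀ r ∈ T, ∀ i j : ι r, i ≠ j → ¬ RepIsoOn r (ρ r i) (ρ r j))
    (hcomplete : ∀ r ∈ T, ∀ (d' : ℕ) (σ : G → Matrix (Fin d') (Fin d') ℂ),
      IsCentIrrep r σ → ∃ i : ι r, RepIsoOn r σ (ρ r i)) :
    ∀ r ∈ T, ∀ i : ι r,
      Mtr r (p r) (ρ r i)
        = (Fintype.card G : ℂ) •
            ∑ r' ∈ T, ∑ i' : ι r',
              (starRingEnd ℂ) (Smat r r' (p r) (p r') (ρ r i) (ρ r' i')) •
                ((((conjClass r').card : ℂ) * ((d r' i' : ℕ) : ℂ))⁻¹ •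
                  Ptr r' (p r') (ρ r' i')) := by
  intro r hr i
  have hG : (Fintype.card G : ℂ) ≠ 0 := Nat.cast_ne_zero.2 Fintype.card_ne_zero
  ext ⟨a, b⟩
  rw [Mtr_apply _ (hp r hr)]
  simp only [Pi.smul_apply, Finset.sum_apply, smul_eq_mul]
  obtain ⟨s, ⟨hs, has⟩, huniq⟩ := hT a
  rw [Finset.sum_eq_single_of_mem s hs fun r' hr' hne => Finset.sum_eq_zero fun i' _ => by
    rw [normalized_Ptr_apply _ (hp r' hr'), if_neg fun h => hne (huniq r' ⟨hr', h.1⟩)]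
    simp]
  simp only [normalized_Ptr_apply _ (hp s hs)]
  by_cases hab : a * b = b * a
  swap
  · simp [hab]
  simp only [has, hab, and_true, if_true, conj_Smat]
  let X : G → G → ℂ := fun c c' => (ρ r i ((p r c)⁻¹ * c' * p r c)).trace
  have hpair (c c' : G) (hc' : c' ∈ conjClass s) :
      (∑ i', (if c * c' = c' * c then
        X c c' * (ρ s i' ((p s c')⁻¹ * c * p s c')).trace else 0) *
          (starRingEnd ℂ) (ρ s i' ((p s a)⁻¹ * b * p s a)).trace) =
        ∑ g : G, if c' = g⁻¹ * a * g ∧ c = g⁻¹ * b * g then X c c' else 0 := by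
    have hpa := hp s hs a has
    have hpc := hp s hs c' hc'
    by_cases hcc : c * c' = c' * c
    · simp only [hcc, if_true, mul_assoc (X c c')]
      rw [← Finset.mul_sum, sum_trace_mul_conj_trace_eq_card (hirr s hs) (hdistinct s hs)
        (hcomplete s hs) ((conj_commutes_iff hpc).2 hcc) ((conj_commutes_iff hpa).2 hab.symm),
        sum_centralizer_ite_eq hpa hpc, Finset.mul_sum]
      simp
    · simp only [hcc, if_false, zero_mul, Finset.sum_const_zero]
      refine (Finset.sum_eq_zero fun g _ => if_neg ?_).symm
      rintro ⟨rfl, rfl⟩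
      refine hcc ?_
      have h1 : g⁻¹ * b * g * (g⁻¹ * a * g) = g⁻¹ * (b * a) * g := by group
      rw [h1, ← hab]
      group
  have hg (g : G) : (∑ c ∈ conjClass r, ∑ c' ∈ conjClass s,
      if c' = g⁻¹ * a * g ∧ c = g⁻¹ * b * g then X c c' else 0) =
        if b ∈ conjClass r then X b a else 0 := by
    simp only [ite_and, Finset.sum_ite_eq', mem_conjClass_conj_iff, has, if_true]
    by_cases hb : b ∈ conjClass r
    · simpa [hb] using (hirr r hr i).1.trace_transversal_conj (hp r hr) hb hab g
    · simp [hb]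
  have key : (∑ i', (∑ c ∈ conjClass r, ∑ c' ∈ conjClass s, if c * c' = c' * c then
        X c c' * (ρ s i' ((p s c')⁻¹ * c * p s c')).trace else 0) *
          (starRingEnd ℂ) (ρ s i' ((p s a)⁻¹ * b * p s a)).trace) =
      Fintype.card G * if b ∈ conjClass r then X b a else 0 := by
    simp only [Finset.sum_mul]
    rw [Finset.sum_comm, Finset.sum_congr rfl fun c _ => Finset.sum_comm,
      Finset.sum_congr rfl fun c _ => Finset.sum_congr rfl fun c' hc' => hpair c c' hc',
      Finset.sum_congr rfl fun c _ => Finset.sum_comm, Finset.sum_comm,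
      Finset.sum_congr rfl fun g _ => hg g]
    simp
  calc _ = (Fintype.card G : ℂ)⁻¹ *
        (Fintype.card G * if b ∈ conjClass r then X b a else 0) := by
        rw [inv_mul_cancel_left₀ hG]
    _ = _ := by
        rw [← key, Finset.mul_sum, Finset.mul_sum]
        refine Finset.sum_congr rfl fun i' _ => ?_
        field_simp
        exact mul_comm _ _

end
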